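/- For n ≤ -2 and 0 ≤ m ≤ -n-1, the squared L² norm of the solid spherical harmonic U_{n,m}^{±} over the exterior domain B^e = {x ∈ ℝ³ : |x| > 1} equals 2π(1+δ_{0,m})(-n-1+m)! / ((2n+3)(2n+1)(-n-1-m)!). -/

import Mathlib

open MeasureTheory Real

noncomputable section

/-- Euclidean space `ℝ³` with coordinates `x 0, x 1, x 2`. -/
abbrev E3 := EuclideanSpace ℝ (Fin 3)

/-- Legendre polynomial of degree `n` via Rodrigues' formula. -/
def legendreP (n : ℕ) (t : ℝ) : ℝ :=
  (1 / (2 ^ n * n.factorial : ℝ)) * iteratedDeriv n (fun s : ℝ => (s ^ 2 - 1) ^ n) t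

/-- Associated Legendre function of nonnegative integer degree `n` and order `m`
(Ferrers-type definition, no Condon–Shortley phase):
`P_n^m(t) = (1-t²)^{m/2} (d/dt)^m P_n(t)`. -/
def assocLegendreNat (n m : ℕ) (t : ℝ) : ℝ :=
  (1 - t ^ 2) ^ ((m : ℝ) / 2) * iteratedDeriv m (legendreP n) t

/-- Associated Legendre function of arbitrary integer degree, using the
reflection `P_{-n}^m = P_{n-1}^m` for negative degrees. -/
def assocLegendre (n : ℤ) (m : ℕ) (t : ℝ) : ℝ :=
  if 0 ≤ n then assocLegendreNat n.toNat m t else assocLegendreNat (-n - 1).toNat m t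

/-- Spherical radius `ρ`. -/
def sphRho (x : E3) : ℝ := Real.sqrt (x 0 ^ 2 + x 1 ^ 2 + x 2 ^ 2)

/-- Azimuthal angle `φ` of the point `(x₁, x₂)`. -/
def sphPhi (x : E3) : ℝ := Complex.arg ⟨x 1, x 2⟩

/-- Azimuthal factor `Φ_m^±(φ)`; `sgn = true` corresponds to `+` (cosine),
`sgn = false` to `−` (sine). -/
def PhiFac (m : ℕ) (sgn : Bool) (φ : ℝ) : ℝ :=
  if sgn then Real.cos (m * φ) else Real.sin (m * φ)

/-- Solid spherical harmonic `U_{n,m}^{±}(x) = ρ^n P_n^m(cos θ) Φ_m^{±}(φ)`. -/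
def solidU (n : ℤ) (m : ℕ) (sgn : Bool) (x : E3) : ℝ :=
  sphRho x ^ n * assocLegendre n m (x 0 / sphRho x) * PhiFac m sgn (sphPhi x)

/-- The exterior `B^e` of the closed unit ball in `ℝ³`. -/
def extB : Set E3 := {x : E3 | 1 < ‖x‖}

open Polynomial in
def Wp (N : ℕ) : Polynomial ℝ := (X ^ 2 - 1) ^ N

def Qp (N j : ℕ) : Polynomial ℝ := Polynomial.derivative^[j] (Wp N)

lemma Qp_succ (N j : ℕ) : Polynomial.derivative (Qp N j) = Qp N (j+1) := by
  rw [Qp, Qp, Function.iterate_succ_apply']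

open Polynomial in
lemma Qp_first (N : ℕ) : (X ^ 2 - 1) * Qp N 1 = 2 * (N : ℝ[X]) * X * Qp N 0 := by
  rw [← Qp_succ]
  simp only [Qp, Function.iterate_zero, id, Wp]
  cases N with
  | zero => simp
  | succ k =>
    simp [derivative_pow, show (C (2:ℝ)) = (2:ℝ[X]) from rfl]
    ring

open Polynomial in
lemma Qp_ode (N j : ℕ) : (X ^ 2 - 1) * Qp N (j+2) + 2 * ((j:ℝ[X]) + 1 - (N:ℝ[X])) * X * Qp N (j+1)
    + ((j:ℝ[X]) + 1) * ((j:ℝ[X]) - 2 * (N:ℝ[X])) * Qp N j = 0 := by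
  induction j with
  | zero =>
    have h := congrArg derivative (Qp_first N)
    simp [derivative_mul, Qp_succ, derivative_pow, show (C (2:ℝ)) = (2:ℝ[X]) from rfl] at h
    simp
    linear_combination h
  | succ j ih =>
    have h := congrArg derivative ih
    simp [derivative_mul, Qp_succ, derivative_pow, show (C (2:ℝ)) = (2:ℝ[X]) from rfl] at h
    push_cast
    linear_combination h

lemma iteratedDeriv_poly (p : Polynomial ℝ) (j : ℕ) :
    iteratedDeriv j (fun t => p.eval t) = fun t => (Polynomial.derivative^[j] p).eval t := by
  induction j with
  | zero => simp
  | succ j ih =>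
    rw [iteratedDeriv_succ, ih, Function.iterate_succ_apply']
    ext t
    simp

lemma legendre_eq (N m : ℕ) (t : ℝ) : iteratedDeriv m (legendreP N) t =
    (1 / (2 ^ N * N.factorial : ℝ)) * (Qp N (N+m)).eval t := by
  have h : legendreP N = fun t => (1 / (2 ^ N * N.factorial : ℝ)) * (Qp N N).eval t := by
    ext t
    have : (fun s : ℝ => (s ^ 2 - 1) ^ N) = fun s => (Wp N).eval s := by ext s; simp [Wp]
    rw [legendreP, this, iteratedDeriv_poly]; rfl
  have h2 : legendreP N = fun t => (Polynomial.C (1 / (2 ^ N * N.factorial : ℝ)) * (Qp N N)).eval t := by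
    rw [h]; ext t; simp
  rw [h2, iteratedDeriv_poly, Polynomial.iterate_derivative_C_mul]
  simp only [Polynomial.eval_mul, Polynomial.eval_C]
  rw [Qp, Qp, ← Function.iterate_add_apply, add_comm m N]

def Iq (N m : ℕ) : ℝ := ∫ t in (-1:ℝ)..1, (1 - t^2)^m * ((Qp N (N+m)).eval t)^2

lemma Iq_succ (N m : ℕ) : Iq N (m+1) = ((N:ℝ) + m + 1) * (N - m) * Iq N m := by
  have hF : ∀ t ∈ Set.uIcc (-1:ℝ) 1, HasDerivAt
      (fun t => (1 - t^2)^(m+1) * (Qp N (N+m+1)).eval t * (Qp N (N+m)).eval t)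
      ((1 - t^2)^(m+1) * ((Qp N (N+(m+1))).eval t)^2 -
        ((N:ℝ) + m + 1) * (N - m) * ((1 - t^2)^m * ((Qp N (N+m)).eval t)^2)) t := by
    intro t _
    have h1 : HasDerivAt (fun t:ℝ => (1 - t^2)) (-(2*t)) t := by
      simpa using (hasDerivAt_pow 2 t).const_sub 1
    have h2 := h1.pow (m+1)
    have h3 := (Qp N (N+m+1)).hasDerivAt t
    have h4 := (Qp N (N+m)).hasDerivAt t
    rw [Qp_succ] at h3 h4
    have h5 := (h2.mul h3).mul h4
    have ho := congrArg (Polynomial.eval t) (Qp_ode N (N+m))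
    simp at ho
    refine h5.congr_deriv ?_
    simp
    rw [← add_assoc N m 1]
    linear_combination (- (1-t^2)^m * (Qp N (N+m)).eval t) * ho
  have hi := intervalIntegral.integral_eq_sub_of_hasDerivAt hF
    (Continuous.intervalIntegrable (by fun_prop) _ _)
  rw [intervalIntegral.integral_sub (Continuous.intervalIntegrable (by fun_prop) _ _)
    (Continuous.intervalIntegrable (by fun_prop) _ _), intervalIntegral.integral_const_mul] at hi
  norm_num at hi
  unfold Iq
  linarith

lemma Bq (N : ℕ) : ∫ t in (-1:ℝ)..1, (1 - t^2)^N = 2 * 4^N * (N.factorial:ℝ)^2 / (2*N+1).factorial := by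
  induction N with
  | zero => simp; norm_num
  | succ N ih =>
    have hF : ∀ t ∈ Set.uIcc (-1:ℝ) 1, HasDerivAt (fun t => t * (1 - t^2)^(N+1))
      ((2*N+3) * (1 - t^2)^(N+1) - (2*N+2) * (1-t^2)^N) t := by
      intro t _
      have h1 : HasDerivAt (fun t:ℝ => (1 - t^2)) (-(2*t)) t := by
        simpa using (hasDerivAt_pow 2 t).const_sub 1
      refine ((hasDerivAt_id t).mul (h1.pow (N+1))).congr_deriv ?_
      simp
      ring
    have hi := intervalIntegral.integral_eq_sub_of_hasDerivAt hF
      (Continuous.intervalIntegrable (by fun_prop) _ _)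
    rw [intervalIntegral.integral_sub (Continuous.intervalIntegrable (by fun_prop) _ _)
      (Continuous.intervalIntegrable (by fun_prop) _ _), intervalIntegral.integral_const_mul,
      intervalIntegral.integral_const_mul, ih] at hi
    norm_num at hi
    have : ∫ t in (-1:ℝ)..1, (1 - t^2)^(N+1) = (2*N+2) * (2 * 4^N * (N.factorial:ℝ)^2 / (2*N+1).factorial) / (2*N+3) := by
      field_simp
      field_simp at hi
      linarith
    rw [this, show 2*(N+1)+1 = (2*N+1+1)+1 by ring, Nat.factorial_succ (2*N+1+1), Nat.factorial_succ (2*N+1), Nat.factorial_succ N]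
    push_cast
    field_simp
    ring

lemma Q_top (N : ℕ) : Qp N (N+N) = Polynomial.C ((2*N).factorial : ℝ) := by
  have hm : (Wp N).Monic := by
    unfold Wp; exact (by monicity! : (Polynomial.X ^ 2 - 1 : Polynomial ℝ).Monic).pow N
  have hd : (Wp N).natDegree = 2*N := by
    unfold Wp
    rw [Polynomial.natDegree_pow, show (Polynomial.X ^ 2 - 1 : Polynomial ℝ).natDegree = 2 by compute_degree!]
    ring
  have h := Polynomial.natDegree_iterate_derivative (Wp N) (N+N)
  rw [hd, show 2*N - (N+N) = 0 by omega] at h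
  have h2 := Polynomial.eq_C_of_natDegree_le_zero h
  rw [Qp, h2, Polynomial.coeff_iterate_derivative]
  have : (Wp N).coeff (0 + (N+N)) = 1 := by
    rw [show 0 + (N+N) = (Wp N).natDegree by rw [hd]; ring]; exact hm
  rw [this]
  simp [Nat.descFactorial_self, two_mul]

lemma Iq_eq (N k : ℕ) : ∀ m, m + k = N → Iq N m = (2 ^ N * N.factorial : ℝ)^2 * (2 / (2*N+1) * (N+m).factorial / (N-m).factorial) := by
  induction k with
  | zero =>
    rintro m rfl
    simp only [add_zero]
    rw [Iq, Q_top]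
    simp only [Polynomial.eval_C]
    rw [intervalIntegral.integral_mul_const, Bq, Nat.factorial_succ (2*m), ← two_mul]
    simp
    have : (4:ℝ)^m = (2^m)^2 := by rw [← pow_mul, mul_comm, pow_mul]; norm_num
    rw [this]
    field_simp
  | succ k ih =>
    intro m hm
    have h := ih (m+1) (by omega)
    rw [Iq_succ] at h
    have hk : (N:ℝ) = m + k + 1 := by rw [← hm]; push_cast; ring
    have h0 : (N:ℝ) - m ≠ 0 := by rw [hk]; ring_nf; positivity
    have e1 : N - m = (N-(m+1)) + 1 := by omega
    have e2 : ((N - (m+1) : ℕ):ℝ) + 1 = N - m := by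
      rw [Nat.cast_sub (by omega)]; push_cast; ring
    rw [e1, Nat.factorial_succ (N-(m+1))]
    rw [← add_assoc, Nat.factorial_succ (N+m)] at h
    push_cast at h ⊢
    rw [e2]
    have h1 : (N:ℝ)+m+1 ≠ 0 := by positivity
    have : Iq N m = (((N:ℝ)+m+1) * (N-m) * Iq N m) / (((N:ℝ)+m+1) * (N-m)) := by field_simp
    rw [this, h]
    field_simp
open scoped ENNReal in
lemma lint_E3 (f : ℝ × ℝ × ℝ → ℝ≥0∞) : ∫⁻ x : E3, f (x 0, x 1, x 2) = ∫⁻ p, f p := by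
  have h1 := EuclideanSpace.volume_preserving_symm_measurableEquiv_toLp (Fin 3)
  have h2 := volume_preserving_piFinSuccAbove (fun _ : Fin 3 => ℝ) 0
  have h3 := (MeasurePreserving.id (volume : Measure ℝ)).prod (volume_preserving_finTwoArrow ℝ)
  have e3 : MeasurableEmbedding (Prod.map id (MeasurableEquiv.finTwoArrow : (Fin 2 → ℝ) ≃ᵐ ℝ × ℝ) : ℝ × (Fin 2 → ℝ) → ℝ × ℝ × ℝ) :=
    ((MeasurableEquiv.refl ℝ).prodCongr (MeasurableEquiv.finTwoArrow : (Fin 2 → ℝ) ≃ᵐ ℝ × ℝ)).measurableEmbedding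
  have a3 := h3.lintegral_comp_emb e3 f
  rw [show (∫⁻ p, f p) = ∫⁻ p, f p ∂((volume : Measure ℝ).prod (volume : Measure (ℝ × ℝ))) from rfl, ← a3]
  rw [show (∫⁻ (a : ℝ × (Fin 2 → ℝ)), f (Prod.map id (MeasurableEquiv.finTwoArrow) a) ∂((volume : Measure ℝ).prod (volume : Measure (Fin 2 → ℝ)))) = ∫⁻ (a : ℝ × (Fin 2 → ℝ)), f (Prod.map id (MeasurableEquiv.finTwoArrow) a) from rfl]
  rw [← h2.lintegral_comp_emb (MeasurableEquiv.measurableEmbedding _)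
    (fun a => f (Prod.map id (MeasurableEquiv.finTwoArrow) a))]
  rw [← h1.lintegral_comp_emb (MeasurableEquiv.measurableEmbedding _)]
  rfl

open scoped ENNReal in
lemma lint_target (u v : ℝ → ℝ≥0∞) (hu : Measurable u) (hv : Measurable v) :
    ∫⁻ p in polarCoord.target, u p.1 * v p.2 =
      (∫⁻ r in Set.Ioi (0:ℝ), u r) * ∫⁻ φ in Set.Ioo (-π) π, v φ := by
  rw [show polarCoord.target = Set.Ioi (0:ℝ) ×ˢ Set.Ioo (-π) π from rfl, Measure.volume_eq_prod,
    ← Measure.prod_restrict, lintegral_prod_mul hu.aemeasurable hv.aemeasurable]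

lemma sqrt_polar {r : ℝ} (hr : 0 < r) (φ : ℝ) : √((r * cos φ)^2 + (r * sin φ)^2) = r := by
  rw [show (r * cos φ)^2 + (r * sin φ)^2 = r^2 * (cos φ^2 + sin φ^2) by ring]
  simp [Real.sqrt_sq hr.le]

lemma arg_polar {r : ℝ} (hr : 0 < r) {φ : ℝ} (hφ : φ ∈ Set.Ioo (-π) π) :
    Complex.arg ⟨r * cos φ, r * sin φ⟩ = φ := by
  refine Eq.trans ?_ (Complex.arg_mul_cos_add_sin_mul_I hr (Set.Ioo_subset_Ioc_self hφ))
  congr 1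
  apply Complex.ext <;> simp [← Complex.ofReal_cos, ← Complex.ofReal_sin]

lemma measurable_arg2 : Measurable (fun q : ℝ × ℝ => Complex.arg ⟨q.1, q.2⟩) :=
  Complex.measurable_arg.comp Complex.measurableEquivRealProd.symm.measurable

open scoped ENNReal in
lemma step1 (G : ℝ × ℝ → ℝ≥0∞) (H : ℝ → ℝ≥0∞) (hG : Measurable G) (hH : Measurable H) :
    ∫⁻ x : E3, G (x 0, √(x 1 ^ 2 + x 2 ^ 2)) * H (Complex.arg ⟨x 1, x 2⟩) =
      (∫⁻ p in {p : ℝ × ℝ | 0 < p.2}, ENNReal.ofReal p.2 * G p) * ∫⁻ φ in Set.Ioo (-π) π, H φ := by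
  have hF : Measurable (fun p : ℝ × ℝ × ℝ => G (p.1, √(p.2.1 ^ 2 + p.2.2 ^ 2)) * H (Complex.arg ⟨p.2.1, p.2.2⟩)) := by
    refine (hG.comp (by fun_prop)).mul (hH.comp (measurable_arg2.comp measurable_snd))
  rw [lint_E3 (fun p : ℝ × ℝ × ℝ => G (p.1, √(p.2.1 ^ 2 + p.2.2 ^ 2)) * H (Complex.arg ⟨p.2.1, p.2.2⟩))]
  rw [Measure.volume_eq_prod, lintegral_prod _ hF.aemeasurable]
  have inner : ∀ a : ℝ, ∫⁻ q : ℝ × ℝ, G (a, √(q.1 ^ 2 + q.2 ^ 2)) * H (Complex.arg ⟨q.1, q.2⟩) =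
      (∫⁻ r in Set.Ioi (0:ℝ), ENNReal.ofReal r * G (a, r)) * ∫⁻ φ in Set.Ioo (-π) π, H φ := by
    intro a
    rw [← lintegral_comp_polarCoord_symm, ← lint_target _ _ (by fun_prop) hH]
    apply setLIntegral_congr_fun polarCoord.open_target.measurableSet
    rintro ⟨r, φ⟩ ⟨hr, hφ⟩
    simp only [polarCoord_symm_apply, smul_eq_mul]
    simp only [Set.mem_Ioi] at hr
    rw [sqrt_polar hr, arg_polar hr hφ, mul_assoc]
  simp only [inner]
  rw [lintegral_mul_const]
  swap
  · exact Measurable.lintegral_prod_right' (f := fun p : ℝ × ℝ => ENNReal.ofReal p.2 * G p) (by fun_prop)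
  congr 1
  rw [show {p : ℝ × ℝ | 0 < p.2} = Set.univ ×ˢ Set.Ioi (0:ℝ) by ext; simp, Measure.volume_eq_prod,
    ← Measure.prod_restrict, lintegral_prod _ (by fun_prop)]
  simp

open scoped ENNReal in
lemma step2 (R T : ℝ → ℝ≥0∞) (hR : Measurable R) (hT : Measurable T) :
    ∫⁻ p in {p : ℝ × ℝ | 0 < p.2}, ENNReal.ofReal p.2 *
      (R √(p.1 ^ 2 + p.2 ^ 2) * T (p.1 / √(p.1 ^ 2 + p.2 ^ 2))) =
      (∫⁻ ρ in Set.Ioi (0:ℝ), ENNReal.ofReal (ρ ^ 2) * R ρ) *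
        ∫⁻ θ in Set.Ioo 0 π, ENNReal.ofReal (sin θ) * T (cos θ) := by
  have hs : MeasurableSet {p : ℝ × ℝ | 0 < p.2} := measurableSet_lt measurable_const measurable_snd
  rw [← lintegral_indicator hs, ← lintegral_comp_polarCoord_symm]
  have e : ∫⁻ θ in Set.Ioo 0 π, ENNReal.ofReal (sin θ) * T (cos θ) =
      ∫⁻ θ in Set.Ioo (-π) π, (Set.Ioo 0 π).indicator (fun θ => ENNReal.ofReal (sin θ) * T (cos θ)) θ := by
    rw [lintegral_indicator measurableSet_Ioo, Measure.restrict_restrict measurableSet_Ioo,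
      Set.inter_eq_left.2 (Set.Ioo_subset_Ioo_left (by linarith [Real.pi_pos]))]
  rw [e, ← lint_target _ _ (by fun_prop) (Measurable.indicator (by fun_prop) measurableSet_Ioo)]
  apply setLIntegral_congr_fun polarCoord.open_target.measurableSet
  rintro ⟨r, φ⟩ ⟨hr, hφ⟩
  simp only [polarCoord_symm_apply, smul_eq_mul]
  simp only [Set.mem_Ioi] at hr
  by_cases h : φ ∈ Set.Ioo 0 π
  · have hp := Real.sin_pos_of_mem_Ioo h
    rw [Set.indicator_of_mem h, Set.indicator_of_mem (by simpa using mul_pos hr hp)]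
    simp only
    rw [sqrt_polar hr, mul_div_cancel_left₀ _ hr.ne', ENNReal.ofReal_mul hr.le, pow_two, ENNReal.ofReal_mul hr.le]
    ring
  · rw [Set.indicator_of_notMem h, Set.indicator_of_notMem]
    · simp
    · have hφ0 : φ ≤ 0 := by
        by_contra h'
        exact h ⟨not_le.1 h', hφ.2⟩
      have := Real.sin_nonpos_of_nonpos_of_neg_pi_le hφ0 hφ.1.le
      simp only [Set.mem_ofPred_eq, not_lt]
      exact mul_nonpos_of_nonneg_of_nonpos hr.le this

lemma radial (n : ℤ) (hn : n ≤ -2) :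
    ∫⁻ ρ in Set.Ioi (0:ℝ), ENNReal.ofReal (ρ ^ 2) *
      (Set.Ioi (1:ℝ)).indicator (fun ρ => ENNReal.ofReal ((ρ ^ n)^2)) ρ =
      ENNReal.ofReal (1 / (-(2 * n + 3))) := by
  have hn' : (n:ℝ) ≤ -2 := by exact_mod_cast hn
  have : ∀ ρ : ℝ, ENNReal.ofReal (ρ ^ 2) *
      (Set.Ioi (1:ℝ)).indicator (fun ρ => ENNReal.ofReal ((ρ ^ n)^2)) ρ =
      (Set.Ioi (1:ℝ)).indicator (fun ρ => ENNReal.ofReal (ρ ^ (2 * n + 2 : ℝ))) ρ := by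
    intro ρ
    by_cases h : ρ ∈ Set.Ioi (1:ℝ)
    · rw [Set.indicator_of_mem h, Set.indicator_of_mem h, ← ENNReal.ofReal_mul (by positivity)]
      have h0 : 0 < ρ := lt_trans one_pos h
      congr 1
      rw [show (2 * n + 2 : ℝ) = ((2 * n + 2 : ℤ) : ℝ) by push_cast; ring, Real.rpow_intCast,
        zpow_add₀ h0.ne', mul_comm 2 n, zpow_mul, mul_comm]
      norm_cast
    · simp [Set.indicator_of_notMem h]
  simp only [this]
  rw [lintegral_indicator measurableSet_Ioi, Measure.restrict_restrict measurableSet_Ioi,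
    Set.inter_eq_left.2 (Set.Ioi_subset_Ioi zero_le_one),
    ← ofReal_integral_eq_lintegral_ofReal, integral_Ioi_rpow_of_lt (by linarith) one_pos]
  · congr 1
    rw [Real.one_rpow, div_eq_div_iff (by linarith) (by linarith)]
    ring
  · exact integrableOn_Ioi_rpow_of_lt (by linarith) one_pos
  · filter_upwards [ae_restrict_mem measurableSet_Ioi] with ρ hρ
    exact Real.rpow_nonneg (lt_trans one_pos hρ).le _

lemma cont_leg (N m : ℕ) : Continuous (assocLegendreNat N m) := by
  have : assocLegendreNat N m = fun t => (1 - t ^ 2) ^ ((m : ℝ) / 2) *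
      ((1 / (2 ^ N * N.factorial : ℝ)) * (Qp N (N+m)).eval t) := by
    ext t; rw [assocLegendreNat, legendre_eq]
  rw [this]
  refine Continuous.mul (Continuous.rpow_const (by fun_prop) fun _ => Or.inr (by positivity)) (by fun_prop)

lemma polar_part (N m : ℕ) (hm : m ≤ N) :
    ∫⁻ θ in Set.Ioo 0 π, ENNReal.ofReal (sin θ) * ENNReal.ofReal (assocLegendreNat N m (cos θ) ^ 2) =
      ENNReal.ofReal (2 / (2*N+1) * (N+m).factorial / (N-m).factorial) := by
  have hc := cont_leg N m
  have h1 : ∀ θ ∈ Set.Ioo 0 π, ENNReal.ofReal (sin θ) * ENNReal.ofReal (assocLegendreNat N m (cos θ) ^ 2)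
    = ENNReal.ofReal (sin θ * assocLegendreNat N m (cos θ) ^ 2) := by
    intro θ hθ
    rw [ENNReal.ofReal_mul (Real.sin_pos_of_mem_Ioo hθ).le]
  rw [setLIntegral_congr_fun measurableSet_Ioo h1, ← ofReal_integral_eq_lintegral_ofReal]
  rotate_left
  · have : Continuous (fun θ => sin θ * assocLegendreNat N m (cos θ) ^ 2) := by fun_prop
    exact (this.integrableOn_Icc (a := 0) (b := π)).mono_set Set.Ioo_subset_Icc_self
  · filter_upwards [ae_restrict_mem measurableSet_Ioo] with θ hθ
    have := (Real.sin_pos_of_mem_Ioo hθ).le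
    simp only [Pi.zero_apply]
    positivity
  congr 1
  rw [← integral_Ioc_eq_integral_Ioo, ← intervalIntegral.integral_of_le Real.pi_pos.le]
  have h2 := intervalIntegral.integral_comp_mul_deriv (a := 0) (b := π) (f := cos) (f' := fun t => - sin t)
    (g := fun t => assocLegendreNat N m t ^ 2) (fun x _ => Real.hasDerivAt_cos x) (by fun_prop) (by fun_prop)
  simp only [Function.comp, Real.cos_zero, Real.cos_pi, mul_neg, intervalIntegral.integral_neg] at h2
  rw [intervalIntegral.integral_symm (-1) 1, neg_inj] at h2
  simp only [mul_comm (sin _)]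
  rw [h2]
  have h3 : ∫ t in (-1:ℝ)..1, assocLegendreNat N m t ^ 2 = ∫ t in (-1:ℝ)..1,
      (1 / (2 ^ N * N.factorial : ℝ))^2 * ((1 - t^2)^m * ((Qp N (N+m)).eval t)^2) := by
    apply intervalIntegral.integral_congr
    intro t ht
    rw [Set.uIcc_of_le (by norm_num)] at ht
    have : 0 ≤ 1 - t^2 := by nlinarith [ht.1, ht.2]
    simp only [assocLegendreNat, legendre_eq]
    rw [mul_pow, ← Real.rpow_natCast (_ ^ _) 2, ← Real.rpow_mul this]
    norm_num
    ring
  have h4 := Iq_eq N (N-m) m (by omega)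
  rw [Iq] at h4
  rw [h3, intervalIntegral.integral_const_mul, h4]
  field_simp

lemma azimuth (m : ℕ) (sgn : Bool) (hsgn : sgn = false → 1 ≤ m) :
    ∫⁻ φ in Set.Ioo (-π) π, ENNReal.ofReal (PhiFac m sgn φ ^ 2) =
      ENNReal.ofReal (π * (1 + if m = 0 then (1 : ℝ) else 0)) := by
  have hc : Continuous (fun φ => PhiFac m sgn φ ^ 2) := by
    unfold PhiFac; cases sgn <;> simp <;> fun_prop
  rw [← ofReal_integral_eq_lintegral_ofReal]
  rotate_left
  · exact (hc.integrableOn_Icc (a := -π) (b := π)).mono_set Set.Ioo_subset_Icc_self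
  · exact Filter.Eventually.of_forall fun φ => sq_nonneg _
  congr 1
  rw [← integral_Ioc_eq_integral_Ioo, ← intervalIntegral.integral_of_le (by linarith [Real.pi_pos])]
  rcases Nat.eq_zero_or_pos m with rfl | hm
  · have : sgn = true := by
      by_contra h
      have := hsgn (by simpa using h)
      omega
    subst this
    simp [PhiFac]; ring
  · have hm0 : (m:ℝ) ≠ 0 := by positivity
    rw [if_neg (by omega)]
    have s1 : sin (m * π) = 0 := Real.sin_nat_mul_pi m
    cases sgn
    · simp only [PhiFac]
      have := intervalIntegral.integral_comp_mul_left (a := -π) (b := π) (fun x => sin x ^ 2) hm0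
      simp only [Bool.false_eq_true, if_false]
      rw [this, integral_sin_sq]
      simp [s1]; field_simp
    · simp only [PhiFac]
      have := intervalIntegral.integral_comp_mul_left (a := -π) (b := π) (fun x => cos x ^ 2) hm0
      simp only [if_true]
      rw [this, integral_cos_sq]
      simp [s1]; field_simp

/-- squared `L²` norm of `U_{n,m}^{±}` over the exterior
`B^e = {|x| > 1}`, for `n ≤ -2`, `0 ≤ m ≤ -n-1`
(`m ≥ 1` required for the `−` case). -/
theorem stmt3 (n : ℤ) (m : ℕ) (sgn : Bool) (hn : n ≤ -2) (hm : (m : ℤ) ≤ -n - 1)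
    (hsgn : sgn = false → 1 ≤ m) :
    ∫ x in extB, (solidU n m sgn x) ^ 2 =
      2 * π * (1 + if m = 0 then (1 : ℝ) else 0) * ((-n - 1 + (m : ℤ)).toNat.factorial : ℝ) /
        (((2 * n + 3) * (2 * n + 1) : ℤ) * ((-n - 1 - (m : ℤ)).toNat.factorial : ℝ)) := by
  obtain ⟨N, hN⟩ : ∃ N : ℕ, -n - 1 = N := ⟨(-n-1).toNat, by omega⟩
  have hA : ∀ t, assocLegendre n m t = assocLegendreNat N m t := by
    intro t
    rw [assocLegendre, if_neg (by omega), hN, Int.toNat_natCast]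
  have hcA := cont_leg N m
  have hnorm : ∀ x : E3, ‖x‖ = sphRho x := by
    intro x
    rw [EuclideanSpace.norm_eq, sphRho, Fin.sum_univ_three]
    simp
  have hmrho : Measurable sphRho := by unfold sphRho; fun_prop
  have hmphi : Measurable sphPhi := by
    unfold sphPhi
    exact measurable_arg2.comp (f := fun x : E3 => (x 1, x 2)) (by fun_prop)
  have hPhi : Measurable (PhiFac m sgn) := by
    unfold PhiFac; cases sgn <;> simp <;> fun_prop
  have hmz : Measurable (fun ρ : ℝ => ρ ^ n) := by fun_prop
  have hU : Measurable (solidU n m sgn) := by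
    have : solidU n m sgn = fun x => sphRho x ^ n * assocLegendreNat N m (x 0 / sphRho x) *
        PhiFac m sgn (sphPhi x) := by
      ext x; rw [solidU, hA]
    rw [this]
    refine ((hmz.comp hmrho).mul (hcA.measurable.comp ?_)).mul (hPhi.comp hmphi)
    exact Measurable.div (by fun_prop) hmrho
  have hext : MeasurableSet extB := measurableSet_lt measurable_const measurable_norm
  rw [integral_eq_lintegral_of_nonneg_ae (Filter.Eventually.of_forall fun x => sq_nonneg _)
    (by fun_prop), ← lintegral_indicator hext]
  set R : ℝ → ENNReal := (Set.Ioi (1:ℝ)).indicator (fun ρ => ENNReal.ofReal ((ρ ^ n)^2)) with hRdef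
  have hR : Measurable R := Measurable.indicator (by fun_prop) measurableSet_Ioi
  set T : ℝ → ENNReal := fun t => ENNReal.ofReal (assocLegendreNat N m t ^ 2) with hTdef
  have hT : Measurable T := by fun_prop
  have key : ∀ x : E3, extB.indicator (fun x => ENNReal.ofReal (solidU n m sgn x ^ 2)) x =
      (fun p : ℝ × ℝ => R √(p.1 ^ 2 + p.2 ^ 2) * T (p.1 / √(p.1 ^ 2 + p.2 ^ 2)))
        (x 0, √(x 1 ^ 2 + x 2 ^ 2)) *
      (fun φ => ENNReal.ofReal (PhiFac m sgn φ ^ 2)) (Complex.arg ⟨x 1, x 2⟩) := by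
    intro x
    have e : √(x 0 ^ 2 + √(x 1 ^ 2 + x 2 ^ 2) ^ 2) = sphRho x := by
      rw [Real.sq_sqrt (by positivity), sphRho, add_assoc]
    simp only [e]
    by_cases h : x ∈ extB
    · have h' : sphRho x ∈ Set.Ioi (1:ℝ) := by rw [← hnorm]; exact h
      rw [Set.indicator_of_mem h, hRdef, Set.indicator_of_mem h', hTdef]
      simp only
      rw [← ENNReal.ofReal_mul (sq_nonneg _), ← ENNReal.ofReal_mul (by positivity), solidU, hA, mul_pow, mul_pow]
      rfl
    · have h' : sphRho x ∉ Set.Ioi (1:ℝ) := by rw [← hnorm]; exact h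
      rw [Set.indicator_of_notMem h, hRdef, Set.indicator_of_notMem h']
      simp
  have hs1 := (lintegral_congr key).trans (step1
    (fun p : ℝ × ℝ => R √(p.1 ^ 2 + p.2 ^ 2) * T (p.1 / √(p.1 ^ 2 + p.2 ^ 2)))
    (fun φ => ENNReal.ofReal (PhiFac m sgn φ ^ 2)) (by fun_prop) (by fun_prop))
  rw [hs1, step2 R T hR hT, hRdef, hTdef, radial n hn,
    polar_part N m (by omega), azimuth m sgn hsgn]
  have hn' : (n:ℝ) ≤ -2 := by exact_mod_cast hn
  have hNr : (N:ℝ) = -n - 1 := by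
    have : ((N:ℤ):ℝ) = ((-n-1 : ℤ) : ℝ) := by rw [hN]
    push_cast at this; exact this
  have hp : (0:ℝ) < -(2*n+3) := by linarith
  have hδ : (0:ℝ) ≤ if m = 0 then (1 : ℝ) else 0 := by split_ifs <;> norm_num
  rw [ENNReal.toReal_mul, ENNReal.toReal_mul, ENNReal.toReal_ofReal (by positivity),
    ENNReal.toReal_ofReal (by positivity), ENNReal.toReal_ofReal (by positivity), hN,
    show ((N:ℤ) + m).toNat = N + m by omega, show ((N:ℤ) - m).toNat = N - m by omega, hNr]
  push_cast
  have a1 : (2 * (n:ℝ) + 3) ≠ 0 := by linarith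
  have a2 : (2 * (n:ℝ) + 1) ≠ 0 := by linarith
  have a3 : (2 * (-(n:ℝ) - 1) + 1) ≠ 0 := by linarith
  rw [show (2 * (-(n:ℝ) - 1) + 1) = -(2 * n + 1) by ring]
  field_simp

end
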